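/- arXiv:1306.6069 — 3 statements merged into one kernel-verified Lean document; each statement's English description precedes it below -/
import Mathlib

section
/- Let m ≥ 1 and t ≥ 1 be integers and let u : ℝ^m → ℝ^t be a smooth map satisfying the pointwise differential inequality Δ(‖u‖²)(x) ≥ 2‖∇u(x)‖² + 2m‖u(x)‖⁴ for all x ∈ ℝ^m. If ∫_{ℝ^m} ‖u‖^p dx < ∞ for some p ∈ (0, ∞), then u is identically zero. -/
open MeasureTheory Metric Real

/-- The Euclidean Laplacian `∑ i, ∂²f/∂xᵢ²` of a map `f : ℝ^m → E`. -/
noncomputable def elap {m : ℕ} {E : Type*} [NormedAddCommGroup E] [NormedSpace ℝ E]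
    (f : EuclideanSpace ℝ (Fin m) → E) (x : EuclideanSpace ℝ (Fin m)) : E :=
  ∑ i : Fin m,
    fderiv ℝ (fun y => fderiv ℝ f y (EuclideanSpace.single i 1)) x (EuclideanSpace.single i 1)

/-- The squared norm of the gradient, `‖∇u(x)‖² = ∑ i, ‖∂u/∂xᵢ(x)‖²`. -/
noncomputable def gradSq {m t : ℕ} (u : EuclideanSpace ℝ (Fin m) → EuclideanSpace ℝ (Fin t))
    (x : EuclideanSpace ℝ (Fin m)) : ℝ :=
  ∑ i : Fin m, ‖fderiv ℝ u x (EuclideanSpace.single i 1)‖ ^ 2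

open Filter Topology

/-- Second-order necessary condition at a local maximum of a function of one variable. -/
theorem IsLocalMax.second_deriv_nonpos {g g' : ℝ → ℝ} {c x : ℝ} (hmax : IsLocalMax g x)
    (hg : ∀ᶠ s in 𝓝 x, HasDerivAt g (g' s) s) (hg' : HasDerivAt g' c x) : c ≤ 0 := by
  by_contra! hc
  have hderiv : deriv g =ᶠ[𝓝 x] g' := hg.mono fun s hs => hs.deriv
  have hdd : deriv (deriv g) x = c := hderiv.deriv_eq.trans hg'.deriv
  have hmin : IsLocalMin g x :=
    isLocalMin_of_deriv_deriv_pos (hdd ▸ hc) hmax.deriv_eq_zero hg.self_of_nhds.continuousAt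
  have hconst : g =ᶠ[𝓝 x] fun _ => g x := by
    filter_upwards [hmax, hmin] with s h₁ h₂ using le_antisymm h₁ h₂
  have hzero : deriv (deriv g) x = 0 := by
    rw [hconst.deriv.deriv_eq]
    simp
  linarith

/-- If `h` is touched from above at `0` by `s ↦ M / (ρ - 2 b s - s²)²`, then its second derivative
at `0` is at most that of this barrier. -/
theorem second_deriv_le_of_le_barrier {h h' : ℝ → ℝ} {c M ρ b : ℝ} (hρ : 0 < ρ)
    (hh : ∀ s, HasDerivAt h (h' s) s) (hh' : HasDerivAt h' c 0)
    (hle : ∀ᶠ s in 𝓝 (0 : ℝ), h s * (ρ - 2 * b * s - s ^ 2) ^ 2 ≤ M)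
    (heq : h 0 * ρ ^ 2 = M) :
    c ≤ M * (4 / ρ ^ 3 + 24 * b ^ 2 / ρ ^ 4) := by
  set q : ℝ → ℝ := fun s => ρ - 2 * b * s - s ^ 2 with hq
  have hqd (s : ℝ) : HasDerivAt q (-2 * b - 2 * s) s := by
    have := ((hasDerivAt_const s ρ).sub ((hasDerivAt_id s).const_mul (2 * b))).sub
      ((hasDerivAt_id s).pow 2)
    refine this.congr_deriv ?_
    simp
  have hq0 : q 0 = ρ := by simp [hq]
  have hqpos : ∀ᶠ s in 𝓝 (0 : ℝ), 0 < q s :=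
    (hqd 0).continuousAt.eventually (lt_mem_nhds (hq0 ▸ hρ))
  have hmax : IsLocalMax (fun s => h s - M / q s ^ 2) 0 := by
    filter_upwards [hle, hqpos] with s hs hs'
    have h₁ : h s ≤ M / q s ^ 2 := (le_div_iff₀ (by positivity)).2 hs
    have h₂ : h 0 = M / q 0 ^ 2 := by
      rw [hq0, eq_div_iff (by positivity)]
      exact heq
    linarith
  have hd : ∀ᶠ s in 𝓝 (0 : ℝ), HasDerivAt (fun s => h s - M / q s ^ 2)
      (h' s - 4 * M * (b + s) / q s ^ 3) s := by
    filter_upwards [hqpos] with s hs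
    refine ((hh s).sub ((hasDerivAt_const s M).div ((hqd s).pow 2) (pow_ne_zero 2 hs.ne'))).congr_deriv ?_
    simp only [Pi.pow_apply]
    field_simp
    ring
  have hdd : HasDerivAt (fun s => h' s - 4 * M * (b + s) / q s ^ 3)
      (c - M * (4 / ρ ^ 3 + 24 * b ^ 2 / ρ ^ 4)) 0 := by
    refine (hh'.sub ((((hasDerivAt_id (0 : ℝ)).const_add b).const_mul (4 * M)).div ((hqd 0).pow 3)
      (by simp only [Pi.pow_apply, hq0]; positivity))).congr_deriv ?_
    simp only [Pi.pow_apply, hq0]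
    simp only [id]
    field_simp
    ring
  linarith [hmax.second_deriv_nonpos hd hdd]

/-- Keller–Osserman interior bound: a nonnegative `C²` function with `Δf ≥ 2 m f²` satisfies
`f ≤ 14 / R²` at the centre of any ball of radius `R`. -/
theorem mul_sq_le_of_two_mul_sq_le_elap {m : ℕ} (hm : 1 ≤ m) {f : EuclideanSpace ℝ (Fin m) → ℝ}
    (hf : ContDiff ℝ 2 f) (hf0 : ∀ x, 0 ≤ f x) (hineq : ∀ x, 2 * m * f x ^ 2 ≤ elap f x)
    (x₀ : EuclideanSpace ℝ (Fin m)) {R : ℝ} (hR : 0 < R) : f x₀ * R ^ 2 ≤ 14 := by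
  set ρ : EuclideanSpace ℝ (Fin m) → ℝ := fun y => R ^ 2 - ‖y - x₀‖ ^ 2 with hρdef
  have hρcont : Continuous ρ := by fun_prop
  obtain ⟨a, ha, hamax⟩ := (isCompact_closedBall x₀ R).exists_isMaxOn
    ⟨x₀, mem_closedBall_self hR.le⟩ (f := fun y => f y * ρ y ^ 2)
    (hf.continuous.mul (hρcont.pow 2)).continuousOn
  set M := f a * ρ a ^ 2 with hM
  have hx₀ : f x₀ * R ^ 4 ≤ M := by
    have := hamax (mem_closedBall_self hR.le)
    simp only [Set.mem_ofPred_eq, hρdef, sub_self, norm_zero] at this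
    linarith
  suffices hMR : M ≤ 14 * R ^ 2 by
    have : f x₀ * R ^ 2 * R ^ 2 ≤ 14 * R ^ 2 := by linarith
    exact le_of_mul_le_mul_right this (by positivity)
  rcases (mul_nonneg (hf0 a) (sq_nonneg (ρ a))).eq_or_lt with h0 | hMpos
  · rw [hM, ← h0]
    positivity
  have hρa : 0 < ρ a := by
    have h₁ : 0 ≤ ρ a := by
      rw [mem_closedBall, dist_eq_norm] at ha
      have := pow_le_pow_left₀ (norm_nonneg _) ha 2
      simp only [hρdef]
      linarith
    refine h₁.lt_of_ne fun h => ?_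
    simp [← h] at hMpos
  have haball : closedBall x₀ R ∈ 𝓝 a := by
    refine mem_of_superset (hρcont.continuousAt.eventually (lt_mem_nhds hρa)) fun y hy => ?_
    rw [mem_closedBall, dist_eq_norm]
    simp only [Set.mem_ofPred_eq, hρdef] at hy
    exact le_of_lt (lt_of_pow_lt_pow_left₀ 2 hR.le (by linarith))
  have hcoord (i : Fin m) :
      fderiv ℝ (fun y => fderiv ℝ f y (EuclideanSpace.single i 1)) a (EuclideanSpace.single i 1)
        ≤ M * (4 / ρ a ^ 3 + 24 * (a - x₀) i ^ 2 / ρ a ^ 4) := by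
    set e : EuclideanSpace ℝ (Fin m) := EuclideanSpace.single i 1 with he
    have hline (s : ℝ) : HasDerivAt (fun s : ℝ => a + s • e) e s := by
      simpa using ((hasDerivAt_id s).smul_const e).const_add a
    have hdir : Differentiable ℝ fun y => fderiv ℝ f y e :=
      ((hf.fderiv_right (m := 1) (by norm_num)).clm_apply contDiff_const).differentiable
        (by norm_num)
    have hρline (s : ℝ) : ρ (a + s • e) = ρ a - 2 * (a - x₀) i * s - s ^ 2 := by
      have hin : inner ℝ (a - x₀) e = (a - x₀) i := by
        simp [he, EuclideanSpace.inner_single_right]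
      have hnorm : ‖e‖ = 1 := by simp [he]
      simp only [hρdef]
      rw [add_sub_right_comm, norm_add_sq_real, inner_smul_right, hin, norm_smul, hnorm,
        Real.norm_eq_abs, mul_one, sq_abs]
      ring
    refine second_deriv_le_of_le_barrier (h := fun s => f (a + s • e))
      (h' := fun s => fderiv ℝ f (a + s • e) e) hρa (fun s => ?_) ?_ ?_ (by simp [hM])
    · exact ((hf.differentiable (by norm_num)) _).hasFDerivAt.comp_hasDerivAt s (hline s)
    · have h := (hdir (a + (0 : ℝ) • e)).hasFDerivAt.comp_hasDerivAt 0 (hline 0)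
      simpa [Function.comp_def] using h
    · have htend : Tendsto (fun s : ℝ => a + s • e) (𝓝 0) (𝓝 a) := by
        simpa using (hline 0).continuousAt.tendsto
      filter_upwards [htend haball] with s hs
      rw [← hρline]
      exact hamax hs
  have hsum : 2 * m * f a ^ 2 ≤ M * (4 * m / ρ a ^ 3 + 24 * ‖a - x₀‖ ^ 2 / ρ a ^ 4) := by
    refine (hineq a).trans ((Finset.sum_le_sum fun i _ => hcoord i).trans_eq ?_)
    rw [← Finset.mul_sum, Finset.sum_add_distrib, ← Finset.sum_div, ← Finset.sum_div,
      ← Finset.mul_sum, EuclideanSpace.real_norm_sq_eq]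
    simp [mul_comm]
  have hm' : (1 : ℝ) ≤ m := by exact_mod_cast hm
  have hkey : M * (2 * m * M) ≤ M * (4 * m * ρ a + 24 * ‖a - x₀‖ ^ 2) := by
    have := mul_le_mul_of_nonneg_right hsum (by positivity : 0 ≤ ρ a ^ 4)
    calc M * (2 * m * M) = 2 * m * f a ^ 2 * ρ a ^ 4 := by rw [hM]; ring
      _ ≤ _ := this
      _ = _ := by field_simp
  have hkey' := le_of_mul_le_mul_left hkey hMpos
  have hρn : ρ a + ‖a - x₀‖ ^ 2 = R ^ 2 := by simp [hρdef]
  have hρR : ρ a ≤ R ^ 2 := by linarith [sq_nonneg ‖a - x₀‖]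
  have hnR : ‖a - x₀‖ ^ 2 ≤ R ^ 2 := by linarith
  have hbound : m * M ≤ m * (14 * R ^ 2) := by
    nlinarith [mul_le_mul_of_nonneg_left hρR (by positivity : (0 : ℝ) ≤ m),
      mul_le_mul_of_nonneg_right hm' (sq_nonneg R)]
  exact le_of_mul_le_mul_left hbound (by positivity)

/-- If a smooth map `u : ℝ^m → ℝ^t` satisfies
`Δ(‖u‖²) ≥ 2‖∇u‖² + 2m‖u‖⁴` pointwise and `∫ ‖u‖^p < ∞` for some `p ∈ (0,∞)`,
then `u ≡ 0`. -/
theorem eq_zero_of_biharmonic_ineq_of_integrable {m t : ℕ} (hm : 1 ≤ m) (ht : 1 ≤ t)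
    (u : EuclideanSpace ℝ (Fin m) → EuclideanSpace ℝ (Fin t)) (hu : ContDiff ℝ (⊤ : ℕ∞) u)
    (hineq : ∀ x, elap (fun y => ‖u y‖ ^ 2) x ≥ 2 * gradSq u x + 2 * m * ‖u x‖ ^ 4)
    (p : ℝ) (hp : 0 < p)
    (hint : Integrable (fun x => ‖u x‖ ^ p)) :
    ∀ x, u x = 0 := by
  intro x
  have hineq' (y) : 2 * m * (‖u y‖ ^ 2) ^ 2 ≤ elap (fun y => ‖u y‖ ^ 2) y := by
    have hgrad : 0 ≤ gradSq u y := Finset.sum_nonneg fun i _ => sq_nonneg _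
    rw [← pow_mul, show 2 * 2 = 4 from rfl]
    linarith [hineq y]
  have hsmooth : ContDiff ℝ 2 fun y => ‖u y‖ ^ 2 :=
    (hu.of_le (WithTop.coe_le_coe.2 le_top)).norm_sq ℝ
  by_contra hx
  have hpos : 0 < ‖u x‖ := norm_pos_iff.2 hx
  have h := mul_sq_le_of_two_mul_sq_le_elap hm hsmooth (fun y => sq_nonneg _) hineq' x
    (div_pos four_pos hpos)
  field_simp at h
  norm_num at h
end

section
/- Let m ≥ 1 and t ≥ 1 be integers and let u : ℝ^m → ℝ^t be a smooth map satisfying the pointwise differential inequality Δ(‖u‖²)(x) ≥ 2‖∇u(x)‖² + 2m‖u(x)‖⁴ for all x ∈ ℝ^m. Then u is identically zero (no integrability assumption on u is required). -/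
open MeasureTheory Metric Real

open Filter Topology

/-- The second-order necessary condition at an interior maximum. -/
theorem deriv_two_nonpos_of_isLocalMax {k k' : ℝ → ℝ} {k₂ x : ℝ}
    (hk : ∀ s, HasDerivAt k (k' s) s) (hk' : HasDerivAt k' k₂ x) (hmax : IsLocalMax k x) :
    k₂ ≤ 0 := by
  by_contra! hpos
  have hd : deriv k = k' := funext fun s => (hk s).deriv
  have hmin : IsLocalMin k x := isLocalMin_of_deriv_deriv_pos (by rwa [hd, hk'.deriv])
    hmax.deriv_eq_zero (hk x).continuousAt
  have hconst : k =ᶠ[𝓝 x] fun _ => k x := by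
    filter_upwards [hmin, hmax] with s h₁ h₂ using le_antisymm h₂ h₁
  have hzero : deriv (deriv k) x = 0 := by
    rw [hconst.deriv.deriv_eq]
    simp
  rw [hd, hk'.deriv] at hzero
  exact hpos.ne' hzero

/-- A bound for the second derivative of `h` at a local maximum of `h` times the square of a
quadratic weight. -/
theorem sq_mul_deriv_two_le_of_isLocalMax {h h' : ℝ → ℝ} {h₂ a c : ℝ} (hc : 0 < c)
    (hh : ∀ s, HasDerivAt h (h' s) s) (hh' : HasDerivAt h' h₂ 0)
    (hmax : IsLocalMax (fun s => (c - 2 * a * s - s ^ 2) ^ 2 * h s) 0) :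
    c ^ 2 * h₂ ≤ (24 * a ^ 2 + 4 * c) * h 0 := by
  have hφ (s : ℝ) : HasDerivAt (fun s => c - 2 * a * s - s ^ 2) (-2 * a - 2 * s) s := by
    refine ((((hasDerivAt_id s).const_mul (2 * a)).const_sub c).sub
      (hasDerivAt_pow 2 s)).congr_deriv ?_
    simp
  have hφ' (s : ℝ) : HasDerivAt (fun s => -2 * a - 2 * s) (-2) s := by
    refine (((hasDerivAt_id s).const_mul 2).const_sub (-2 * a)).congr_deriv ?_
    simp
  have hk (s : ℝ) : HasDerivAt (fun s => (c - 2 * a * s - s ^ 2) ^ 2 * h s)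
      (2 * (c - 2 * a * s - s ^ 2) * (-2 * a - 2 * s) * h s
        + (c - 2 * a * s - s ^ 2) ^ 2 * h' s) s := by
    refine (((hφ s).pow 2).mul (hh s)).congr_deriv ?_
    simp
  have hk' := ((((hφ 0).const_mul 2).mul (hφ' 0)).mul (hh 0)).add (((hφ 0).pow 2).mul hh')
  have hfirst := hmax.hasDerivAt_eq_zero (hk 0)
  have hsecond := deriv_two_nonpos_of_isLocalMax hk hk' hmax
  simp at hfirst hsecond
  have hcrit : c * h' 0 = 4 * a * h 0 := by
    apply mul_left_cancel₀ hc.ne'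
    linear_combination hfirst
  have hcrit' : c * h' 0 * a = 4 * a * h 0 * a := by rw [hcrit]
  nlinarith

/-- A bound for the Laplacian of `f` at an interior maximum over the ball of radius `R` of
`(R² - ‖y - x₀‖²)² f(y)`. -/
theorem sq_mul_elap_le_of_isLocalMax {m : ℕ} {f : EuclideanSpace ℝ (Fin m) → ℝ}
    (hf : ContDiff ℝ 2 f) {x₀ p : EuclideanSpace ℝ (Fin m)} {R : ℝ}
    (hp : 0 < R ^ 2 - ‖p - x₀‖ ^ 2)
    (hmax : IsLocalMax (fun y => (R ^ 2 - ‖y - x₀‖ ^ 2) ^ 2 * f y) p) :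
    (R ^ 2 - ‖p - x₀‖ ^ 2) ^ 2 * elap f p ≤
      (24 * ‖p - x₀‖ ^ 2 + 4 * m * (R ^ 2 - ‖p - x₀‖ ^ 2)) * f p := by
  have hline (e : EuclideanSpace ℝ (Fin m)) (s : ℝ) :
      HasDerivAt (fun s : ℝ => p + s • e) e s := by
    simpa using ((hasDerivAt_id s).smul_const e).const_add p
  have key (i : Fin m) : (R ^ 2 - ‖p - x₀‖ ^ 2) ^ 2 *
      fderiv ℝ (fun y => fderiv ℝ f y (EuclideanSpace.single i 1)) p (EuclideanSpace.single i 1) ≤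
      (24 * ((p - x₀) i) ^ 2 + 4 * (R ^ 2 - ‖p - x₀‖ ^ 2)) * f p := by
    set e : EuclideanSpace ℝ (Fin m) := EuclideanSpace.single i 1 with he
    have hp0 : p = p + (0 : ℝ) • e := by simp
    have hfd : Differentiable ℝ f := hf.differentiable (by norm_num)
    have hfd' : Differentiable ℝ (fun y => fderiv ℝ f y e) :=
      ((hf.fderiv_right (m := 1) (by norm_num)).differentiable (by norm_num)).clm_apply
        (differentiable_const e)
    have h₁ (s : ℝ) : HasDerivAt (fun s : ℝ => f (p + s • e)) (fderiv ℝ f (p + s • e) e) s :=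
      (hfd _).hasFDerivAt.comp_hasDerivAt s (hline e s)
    have h₂ : HasDerivAt (fun s : ℝ => fderiv ℝ f (p + s • e) e)
        (fderiv ℝ (fun y => fderiv ℝ f y e) p e) 0 := by
      have := (hfd' (p + (0 : ℝ) • e)).hasFDerivAt.comp_hasDerivAt 0 (hline e 0)
      rwa [← hp0] at this
    have hnorm (s : ℝ) : ‖p + s • e - x₀‖ ^ 2 = ‖p - x₀‖ ^ 2 + 2 * ((p - x₀) i) * s + s ^ 2 := by
      rw [show p + s • e - x₀ = (p - x₀) + s • e by abel, norm_add_sq_real, inner_smul_right,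
        norm_smul, he, EuclideanSpace.inner_single_right]
      simp
      ring
    have hmax' : IsLocalMax
        (fun s : ℝ => (R ^ 2 - ‖p - x₀‖ ^ 2 - 2 * ((p - x₀) i) * s - s ^ 2) ^ 2
          * f (p + s • e)) 0 := by
      have ht : Tendsto (fun s : ℝ => p + s • e) (𝓝 0) (𝓝 p) := by
        simpa using (hline e 0).continuousAt.tendsto
      filter_upwards [ht.eventually hmax] with s hs
      rw [hnorm] at hs
      convert hs using 1
      · ring
      · simp
    simpa using sq_mul_deriv_two_le_of_isLocalMax hp h₁ h₂ hmax'
  calc (R ^ 2 - ‖p - x₀‖ ^ 2) ^ 2 * elap f p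
      ≤ ∑ i, (24 * ((p - x₀) i) ^ 2 + 4 * (R ^ 2 - ‖p - x₀‖ ^ 2)) * f p := by
        rw [elap, Finset.mul_sum]
        exact Finset.sum_le_sum fun i _ => key i
    _ = (24 * ‖p - x₀‖ ^ 2 + 4 * m * (R ^ 2 - ‖p - x₀‖ ^ 2)) * f p := by
        rw [← Finset.sum_mul, Finset.sum_add_distrib, ← Finset.mul_sum,
          EuclideanSpace.real_norm_sq_eq (p - x₀), Finset.sum_const, Finset.card_univ,
          Fintype.card_fin, nsmul_eq_mul]
        ring

/-- An a priori interior estimate of Keller–Osserman type: a solution of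
`Δf ≥ 2m f²` satisfies `f ≤ 14 / R²` at the centre of any ball of radius `R`. -/
theorem sq_mul_le_of_elap_ge_sq {m : ℕ} (hm : 1 ≤ m) {f : EuclideanSpace ℝ (Fin m) → ℝ}
    (hf : ContDiff ℝ 2 f) (hlap : ∀ x, 2 * m * f x ^ 2 ≤ elap f x)
    (x₀ : EuclideanSpace ℝ (Fin m)) {R : ℝ} (hR : 0 < R) : R ^ 2 * f x₀ ≤ 14 := by
  by_contra! hlt
  have hfx : 0 < f x₀ := by
    by_contra! hle
    nlinarith [sq_nonneg R]
  obtain ⟨p, hpmem, hpmax⟩ := (isCompact_closedBall x₀ R).exists_isMaxOn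
    ⟨x₀, mem_closedBall_self hR.le⟩
    (f := fun y => (R ^ 2 - ‖y - x₀‖ ^ 2) ^ 2 * f y)
    (by have := hf.continuous; fun_prop)
  have hcenter : (R ^ 2) ^ 2 * f x₀ ≤ (R ^ 2 - ‖p - x₀‖ ^ 2) ^ 2 * f p := by
    simpa using hpmax (mem_closedBall_self hR.le)
  rw [mem_closedBall, dist_eq_norm] at hpmem
  have hpos : 0 < (R ^ 2 - ‖p - x₀‖ ^ 2) ^ 2 * f p := lt_of_lt_of_le (by positivity) hcenter
  have hlt' : ‖p - x₀‖ < R := by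
    refine lt_of_le_of_ne hpmem fun heq => ?_
    rw [heq] at hpos
    simp at hpos
  have hφ : 0 < R ^ 2 - ‖p - x₀‖ ^ 2 := by nlinarith [norm_nonneg (p - x₀)]
  have hfp : 0 < f p := pos_of_mul_pos_right hpos (by positivity)
  have hest := sq_mul_elap_le_of_isLocalMax hf hφ
    (hpmax.isLocalMax (closedBall_mem_nhds_of_mem (by rwa [mem_ball, dist_eq_norm])))
  have hm' : (1 : ℝ) ≤ m := by exact_mod_cast hm
  have hupper : 2 * m * ((R ^ 2 - ‖p - x₀‖ ^ 2) ^ 2 * f p) ≤ 2 * m * (14 * R ^ 2) := by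
    have h₁ : (R ^ 2 - ‖p - x₀‖ ^ 2) ^ 2 * (2 * m * f p ^ 2) ≤
        (24 * ‖p - x₀‖ ^ 2 + 4 * m * (R ^ 2 - ‖p - x₀‖ ^ 2)) * f p :=
      (mul_le_mul_of_nonneg_left (hlap p) (sq_nonneg _)).trans hest
    have h₂ : 2 * m * ((R ^ 2 - ‖p - x₀‖ ^ 2) ^ 2 * f p) ≤
        24 * ‖p - x₀‖ ^ 2 + 4 * m * (R ^ 2 - ‖p - x₀‖ ^ 2) := by
      refine le_of_mul_le_mul_right ?_ hfp
      linarith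
    nlinarith [mul_nonneg (sub_nonneg.2 hm') (sq_nonneg R),
      mul_nonneg (sub_nonneg.2 hm') (sq_nonneg ‖p - x₀‖), sq_nonneg ‖p - x₀‖]
  have hupper' := le_of_mul_le_mul_left hupper (by positivity)
  nlinarith [mul_lt_mul_of_pos_left hlt (pow_pos hR 2)]

/-- If a smooth map `u : ℝ^m → ℝ^t` satisfies
`Δ(‖u‖²) ≥ 2‖∇u‖² + 2m‖u‖⁴` pointwise, then `u ≡ 0` (no integrability needed). -/
theorem eq_zero_of_biharmonic_ineq {m t : ℕ} (hm : 1 ≤ m) (ht : 1 ≤ t)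
    (u : EuclideanSpace ℝ (Fin m) → EuclideanSpace ℝ (Fin t)) (hu : ContDiff ℝ (⊤ : ℕ∞) u)
    (hineq : ∀ x, elap (fun y => ‖u y‖ ^ 2) x ≥ 2 * gradSq u x + 2 * m * ‖u x‖ ^ 4) :
    ∀ x, u x = 0 := by
  intro x
  by_contra hx
  have hpos : 0 < ‖u x‖ ^ 2 := by positivity
  have hf : ContDiff ℝ 2 fun y => ‖u y‖ ^ 2 :=
    (hu.of_le (WithTop.coe_le_coe.2 (le_top : (2 : ℕ∞) ≤ ⊤))).norm_sq ℝ
  have hlap (y : EuclideanSpace ℝ (Fin m)) :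
      2 * m * (‖u y‖ ^ 2) ^ 2 ≤ elap (fun y => ‖u y‖ ^ 2) y := by
    have hgrad : 0 ≤ gradSq u y := Finset.sum_nonneg fun i _ => by positivity
    have := hineq y
    linarith [pow_mul ‖u y‖ 2 2]
  have hbound := sq_mul_le_of_elap_ge_sq hm hf hlap x
    (R := 4 / ‖u x‖) (by positivity)
  have : (4 / ‖u x‖) ^ 2 * ‖u x‖ ^ 2 = 16 := by
    field_simp
    norm_num
  linarith
end

section
/- Let m ≥ 1 and t ≥ 1 be integers, let ε > 0 and p ≥ 0 be real constants, and let u : ℝ^m → ℝ^t be a smooth map satisfying the pointwise differential inequality Δ(‖u‖²)(x) ≥ 2‖∇u(x)‖² + 2mε‖u(x)‖² for all x ∈ ℝ^m. If the function ρ ↦ ∫_{B_ρ} ‖u‖^{p+2} dx is of at most polynomial growth, i.e. there exist C > 0 and a natural number s with ∫_{B_ρ} ‖u‖^{p+2} dx ≤ C(1 + ρ^s) for all ρ > 0, then u is identically zero. -/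
open MeasureTheory Metric Real

section Laplacian

variable {m : ℕ}

lemma ContDiff.fderiv_apply_const {n : WithTop ℕ∞} {f : EuclideanSpace ℝ (Fin m) → ℝ}
    (hf : ContDiff ℝ (n + 1) f) (v : EuclideanSpace ℝ (Fin m)) :
    ContDiff ℝ n (fun y => fderiv ℝ f y v) :=
  (hf.fderiv_right le_rfl).clm_apply contDiff_const

lemma HasCompactSupport.fderiv_apply_const {f : EuclideanSpace ℝ (Fin m) → ℝ}
    (hf : HasCompactSupport f) (v : EuclideanSpace ℝ (Fin m)) :
    HasCompactSupport (fun y => fderiv ℝ f y v) :=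
  (hf.fderiv (𝕜 := ℝ)).comp_left (g := fun L : EuclideanSpace ℝ (Fin m) →L[ℝ] ℝ => L v) (by simp)

lemma continuous_fderiv_fderiv {f : EuclideanSpace ℝ (Fin m) → ℝ} (hf : ContDiff ℝ 2 f)
    (v : EuclideanSpace ℝ (Fin m)) :
    Continuous (fun x => fderiv ℝ (fun y => fderiv ℝ f y v) x v) := by
  have h1 : ContDiff ℝ 1 (fun y => fderiv ℝ f y v) :=
    ContDiff.fderiv_apply_const (by simpa [one_add_one_eq_two] using hf) v
  exact (ContDiff.fderiv_apply_const (n := 0) (by simpa using h1) v).continuous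

lemma continuous_elap {f : EuclideanSpace ℝ (Fin m) → ℝ} (hf : ContDiff ℝ 2 f) :
    Continuous (elap f) :=
  continuous_finsetSum _ fun _ _ => continuous_fderiv_fderiv hf _

lemma support_elap_subset (f : EuclideanSpace ℝ (Fin m) → ℝ) :
    Function.support (elap f) ⊆ tsupport f := by
  intro x hx
  by_contra hxs
  apply hx
  have h0 : f =ᶠ[nhds x] fun _ => 0 := notMem_tsupport_iff_eventuallyEq.mp hxs
  refine Finset.sum_eq_zero fun i _ => ?_
  have h1 : (fun y => fderiv ℝ f y (EuclideanSpace.single i 1)) =ᶠ[nhds x] fun _ => 0 := by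
    filter_upwards [h0.eventuallyEq_nhds] with y hy
    rw [hy.fderiv_eq]; simp
  rw [h1.fderiv_eq]; simp

lemma elap_comp_smul (f : EuclideanSpace ℝ (Fin m) → ℝ) (c : ℝ) (x : EuclideanSpace ℝ (Fin m)) :
    elap (fun y => f (c • y)) x = c ^ 2 * elap f (c • x) := by
  unfold elap
  rw [Finset.mul_sum]
  refine Finset.sum_congr rfl fun i _ => ?_
  have h1 : (fun y => fderiv ℝ (fun y => f (c • y)) y (EuclideanSpace.single i 1)) =
      c • fun y => (fun z => fderiv ℝ f z (EuclideanSpace.single i 1)) (c • y) := by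
    ext y
    rw [fderiv_comp_smul]; rfl
  rw [h1, fderiv_const_smul_field, Pi.smul_apply,
    fderiv_comp_smul (f := fun z => fderiv ℝ f z (EuclideanSpace.single i 1))]
  simp [pow_two, mul_assoc]

lemma integral_mul_elap {f g : EuclideanSpace ℝ (Fin m) → ℝ} (hf : ContDiff ℝ 2 f)
    (hfs : HasCompactSupport f) (hg : ContDiff ℝ 2 g) :
    ∫ x, f x * elap g x = ∫ x, elap f x * g x := by
  unfold elap
  simp_rw [Finset.mul_sum, Finset.sum_mul]
  have dC : ∀ {h : EuclideanSpace ℝ (Fin m) → ℝ}, ContDiff ℝ 2 h →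
      ∀ v, ContDiff ℝ 1 (fun y => fderiv ℝ h y v) := fun hh v =>
    ContDiff.fderiv_apply_const (by simpa [one_add_one_eq_two] using hh) v
  have int : ∀ {a b : EuclideanSpace ℝ (Fin m) → ℝ}, Continuous a → HasCompactSupport a →
      Continuous b → Integrable (fun x => a x * b x) := fun ha hs hb =>
    (ha.mul hb).integrable_of_hasCompactSupport hs.mul_right
  rw [integral_finsetSum, integral_finsetSum]
  · refine Finset.sum_congr rfl fun i _ => ?_
    set v : EuclideanSpace ℝ (Fin m) := EuclideanSpace.single i 1
    have hf1 := dC hf v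
    have hg1 := dC hg v
    have hs1 := hfs.fderiv_apply_const v
    have hs2 := hs1.fderiv_apply_const v
    rw [integral_mul_fderiv_eq_neg_fderiv_mul_of_integrable
        (int hf1.continuous hs1 hg1.continuous)
        (int hf.continuous hfs (continuous_fderiv_fderiv hg v))
        (int hf.continuous hfs hg1.continuous)
        (fun x _ => hf.differentiable (by norm_num) x)
        (fun x _ => hg1.differentiable (by norm_num) x),
      integral_mul_fderiv_eq_neg_fderiv_mul_of_integrable
        (int (continuous_fderiv_fderiv hf v) hs2 hg.continuous)
        (int hf1.continuous hs1 hg1.continuous)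
        (int hf1.continuous hs1 hg.continuous)
        (fun x _ => hf1.differentiable (by norm_num) x)
        (fun x _ => hg.differentiable (by norm_num) x), neg_neg]
  · exact fun i _ => int (continuous_fderiv_fderiv hf _)
      ((hfs.fderiv_apply_const _).fderiv_apply_const _) hg.continuous
  · exact fun i _ => int hf.continuous hfs (continuous_fderiv_fderiv hg _)

lemma le_elap_rpow {f : EuclideanSpace ℝ (Fin m) → ℝ} (hf : ContDiff ℝ 2 f)
    (hpos : ∀ x, 0 < f x) {q : ℝ} (hq : 1 ≤ q) (x : EuclideanSpace ℝ (Fin m)) :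
    q * f x ^ (q - 1) * elap f x ≤ elap (fun y => f y ^ q) x := by
  unfold elap
  rw [Finset.mul_sum]
  refine Finset.sum_le_sum fun i _ => ?_
  set v : EuclideanSpace ℝ (Fin m) := EuclideanSpace.single i 1
  have hd : ∀ y, HasFDerivAt f (fderiv ℝ f y) y := fun y =>
    (hf.differentiable (by norm_num) y).hasFDerivAt
  have h1 : (fun y => fderiv ℝ (fun y => f y ^ q) y v) =
      fun y => q * f y ^ (q - 1) * fderiv ℝ f y v := by
    ext y
    rw [((hd y).rpow_const (Or.inl (hpos y).ne')).fderiv]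
    simp
  have hf1 : ContDiff ℝ 1 (fun y => fderiv ℝ f y v) :=
    ContDiff.fderiv_apply_const (by simpa [one_add_one_eq_two] using hf) v
  have h2 := ((((hd x).rpow_const (p := q - 1) (Or.inl (hpos x).ne')).const_mul q).mul
    (hf1.differentiable (by norm_num) x).hasFDerivAt)
  rw [h1, show fderiv ℝ (fun y => q * f y ^ (q - 1) * fderiv ℝ f y v) x = _ from h2.fderiv]
  have h3 : 0 ≤ fderiv ℝ f x v * (q * ((q - 1) * f x ^ (q - 1 - 1) * fderiv ℝ f x v)) := by
    have : 0 ≤ q * (q - 1) * f x ^ (q - 1 - 1) * (fderiv ℝ f x v) ^ 2 := by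
      have := (rpow_pos_of_pos (hpos x) (q - 1 - 1)).le
      have : 0 ≤ q - 1 := by linarith
      positivity
    linarith
  simpa using h3

end Laplacian

/-- A Caccioppoli type estimate for nonnegative functions with `Δf ≥ κf`. -/
lemma exists_setIntegral_closedBall_le {m : ℕ} {f : EuclideanSpace ℝ (Fin m) → ℝ}
    (hf : ContDiff ℝ 2 f) (hnonneg : ∀ x, 0 ≤ f x) {κ q : ℝ} (hκ : 0 < κ) (hq : 1 ≤ q)
    (hineq : ∀ x, κ * f x ≤ elap f x) :
    ∃ A : ℝ, 0 ≤ A ∧ ∀ R > 0, ∫ x in closedBall 0 R, f x ^ q ≤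
      A / R ^ 2 * ∫ x in closedBall 0 (2 * R), f x ^ q := by
  have hq0 : 0 < q := by linarith
  let b : ContDiffBump (0 : EuclideanSpace ℝ (Fin m)) := ⟨1, 2, by norm_num, by norm_num⟩
  have hb : ContDiff ℝ 2 b := b.contDiff
  have hbs : HasCompactSupport (elap b) :=
    HasCompactSupport.intro' b.hasCompactSupport (isClosed_tsupport _)
      fun x hx => by_contra fun h => hx (support_elap_subset _ h)
  obtain ⟨B, hB⟩ := (continuous_elap hb).bounded_above_of_compact_support hbs
  have hB0 : 0 ≤ B := (norm_nonneg _).trans (hB 0)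
  refine ⟨B / (q * κ), by positivity, fun R hR => ?_⟩
  set φ : EuclideanSpace ℝ (Fin m) → ℝ := fun x => b (R⁻¹ • x) with hφ_def
  have hφ : ContDiff ℝ 2 φ := hb.comp (contDiff_const_smul _)
  have hφ0 : ∀ x, 0 ≤ φ x := fun x => b.nonneg
  have hφ1 : ∀ x ∈ closedBall (0 : EuclideanSpace ℝ (Fin m)) R, φ x = 1 := by
    intro x hx
    apply b.one_of_mem_closedBall
    have : ‖x‖ ≤ R := by simpa using hx
    simp only [mem_closedBall, dist_zero_right, norm_smul, norm_inv, Real.norm_eq_abs,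
      abs_of_pos hR, b]
    rw [inv_mul_le_iff₀ hR]; linarith
  have hφs : HasCompactSupport φ := b.hasCompactSupport.comp_smul (inv_ne_zero hR.ne')
  have htsupp : tsupport φ ⊆ closedBall 0 (2 * R) := by
    refine closure_minimal (fun x hx => ?_) isClosed_closedBall
    have h2 : R⁻¹ • x ∈ ball (0 : EuclideanSpace ℝ (Fin m)) 2 := by
      have : R⁻¹ • x ∈ Function.support b := hx
      rwa [b.support_eq] at this
    simp only [mem_ball, dist_zero_right, norm_smul, norm_inv, Real.norm_eq_abs,
      abs_of_pos hR] at h2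
    rw [inv_mul_lt_iff₀ hR] at h2
    simpa [mul_comm] using h2.le
  have hlap0 : ∀ x ∉ closedBall (0 : EuclideanSpace ℝ (Fin m)) (2 * R), elap φ x = 0 :=
    fun x hx => by_contra fun h => hx (htsupp (support_elap_subset _ h))
  have hlapB : ∀ x, elap φ x ≤ B / R ^ 2 := by
    intro x
    rw [hφ_def, elap_comp_smul, inv_pow, div_eq_inv_mul]
    gcongr
    exact (le_abs_self _).trans (hB _)
  have hfq : Continuous fun x => f x ^ q := hf.continuous.rpow_const fun _ => Or.inr hq0.le
  have key : ∀ δ > 0, q * κ * ∫ x in closedBall 0 R, f x ^ q ≤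
      B / R ^ 2 * ∫ x in closedBall 0 (2 * R), (f x + δ) ^ q := by
    intro δ hδ
    have hpos : ∀ x, 0 < f x + δ := fun x => by have := hnonneg x; linarith
    have hfδ : ContDiff ℝ 2 fun x => f x + δ := hf.add contDiff_const
    have hw : ContDiff ℝ 2 fun x => (f x + δ) ^ q :=
      hfδ.rpow_const_of_ne fun x => (hpos x).ne'
    have hlap : ∀ x, q * κ * f x ^ q ≤ elap (fun y => (f y + δ) ^ q) x := by
      intro x
      refine le_trans ?_ (le_elap_rpow hfδ hpos hq x)
      have e1 : elap (fun y => f y + δ) x = elap f x := by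
        unfold elap; simp
      rw [e1]
      have e2 : f x ^ q ≤ (f x + δ) ^ (q - 1) * f x := by
        rcases (hnonneg x).eq_or_lt with h | h
        · rw [← h, zero_rpow hq0.ne', mul_zero]
        · rw [show f x ^ q = f x ^ (q - 1) * f x by
            rw [← rpow_add_one h.ne']; ring_nf]
          have : 0 ≤ q - 1 := by linarith
          gcongr; linarith
      have e3 : 0 ≤ (f x + δ) ^ (q - 1) := (rpow_pos_of_pos (hpos x) _).le
      calc q * κ * f x ^ q ≤ q * κ * ((f x + δ) ^ (q - 1) * f x) := by gcongr
        _ = q * (f x + δ) ^ (q - 1) * (κ * f x) := by ring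
        _ ≤ _ := by gcongr; exact hineq x
    have hint : Integrable fun x => φ x * elap (fun y => (f y + δ) ^ q) x :=
      (hφ.continuous.mul (continuous_elap hw)).integrable_of_hasCompactSupport hφs.mul_right
    calc q * κ * ∫ x in closedBall 0 R, f x ^ q
        = ∫ x in closedBall 0 R, q * κ * f x ^ q := (integral_const_mul _ _).symm
      _ ≤ ∫ x in closedBall 0 R, φ x * elap (fun y => (f y + δ) ^ q) x := by
          refine setIntegral_mono_on ?_ hint.integrableOn measurableSet_closedBall ?_
          · exact (hfq.const_mul _).continuousOn.integrableOn_compact (isCompact_closedBall _ _)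
          · intro x hx
            rw [hφ1 x hx, one_mul]; exact hlap x
      _ ≤ ∫ x, φ x * elap (fun y => (f y + δ) ^ q) x := by
          refine setIntegral_le_integral hint (Filter.Eventually.of_forall fun x => ?_)
          refine mul_nonneg (hφ0 x) (le_trans ?_ (hlap x))
          have := rpow_nonneg (hnonneg x) q
          positivity
      _ = ∫ x, elap φ x * (f x + δ) ^ q := integral_mul_elap hφ hφs hw
      _ = ∫ x in closedBall 0 (2 * R), elap φ x * (f x + δ) ^ q := by
          refine (setIntegral_eq_integral_of_forall_compl_eq_zero fun x hx => ?_).symm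
          rw [hlap0 x hx, zero_mul]
      _ ≤ ∫ x in closedBall 0 (2 * R), B / R ^ 2 * (f x + δ) ^ q := by
          refine setIntegral_mono_on ?_ ?_ measurableSet_closedBall ?_
          · exact ((continuous_elap hφ).mul hw.continuous).continuousOn.integrableOn_compact
              (isCompact_closedBall _ _)
          · exact (hw.continuous.const_mul _).continuousOn.integrableOn_compact
              (isCompact_closedBall _ _)
          · intro x _
            have := rpow_nonneg (hpos x).le q
            gcongr; exact hlapB x
      _ = _ := integral_const_mul _ _
  have hcont : Continuous fun δ : ℝ =>
      ∫ x in closedBall (0 : EuclideanSpace ℝ (Fin m)) (2 * R), (f x + δ) ^ q := by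
    refine continuous_parametric_integral_of_continuous ?_ (isCompact_closedBall _ _)
    exact ((hf.continuous.comp continuous_snd).add continuous_fst).rpow_const
      fun _ => Or.inr hq0.le
  have hlim : Filter.Tendsto (fun δ : ℝ => B / R ^ 2 *
      ∫ x in closedBall (0 : EuclideanSpace ℝ (Fin m)) (2 * R), (f x + δ) ^ q)
      (nhdsWithin 0 (Set.Ioi 0))
      (nhds (B / R ^ 2 * ∫ x in closedBall 0 (2 * R), f x ^ q)) := by
    have := ((hcont.const_mul (B / R ^ 2)).tendsto 0).mono_left
      (nhdsWithin_le_nhds (s := Set.Ioi 0))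
    simpa using this
  have hfin := ge_of_tendsto hlim (Filter.eventually_of_mem self_mem_nhdsWithin key)
  have hqκ : 0 < q * κ := by positivity
  rw [← le_div_iff₀' hqκ] at hfin
  refine hfin.trans_eq ?_
  field_simp

/-- A function of polynomial growth with `W(R) ≤ A R⁻² W(2R)` vanishes for large arguments. -/
lemma exists_forall_le_nonpos_of_doubling {W : ℝ → ℝ} {A C : ℝ} {s : ℕ} (hA : 0 ≤ A)
    (hW : ∀ R > 0, W R ≤ A / R ^ 2 * W (2 * R)) (hgrowth : ∀ R > 0, W R ≤ C * (1 + R ^ s)) :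
    ∃ R₀ : ℝ, ∀ R ≥ R₀, W R ≤ 0 := by
  have hlim : Filter.Tendsto (fun R : ℝ => A / R ^ 2 * 2 ^ s) Filter.atTop (nhds 0) := by
    have := (tendsto_const_nhds (x := A)).div_atTop
      (Filter.tendsto_pow_atTop (α := ℝ) two_ne_zero)
    simpa using this.mul_const ((2 : ℝ) ^ s)
  obtain ⟨R₀, hR₀⟩ := Filter.eventually_atTop.mp
    ((hlim.eventually_lt_const one_pos).and (Filter.eventually_gt_atTop 0))
  refine ⟨R₀, fun R hR => ?_⟩
  obtain ⟨hlt, hRpos⟩ := hR₀ R hR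
  set θ := A / R ^ 2 with hθ
  have hθ0 : 0 ≤ θ := by positivity
  have hθ1 : θ < 1 := by
    have : θ * 1 ≤ θ * 2 ^ s := by gcongr; exact one_le_pow₀ one_le_two
    linarith
  have iter : ∀ n : ℕ, W R ≤ θ ^ n * W (2 ^ n * R) ∨ W R ≤ 0 := by
    intro n
    induction n with
    | zero => simp
    | succ n ih =>
      rcases ih with ih | ih
      · by_cases h0 : W (2 * (2 ^ n * R)) ≤ 0
        · right
          have h1 := hW (2 ^ n * R) (by positivity)
          have h2 : W (2 ^ n * R) ≤ 0 :=
            h1.trans (mul_nonpos_of_nonneg_of_nonpos (by positivity) h0)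
          exact ih.trans (mul_nonpos_of_nonneg_of_nonpos (by positivity) h2)
        · left
          have h1 := hW (2 ^ n * R) (by positivity)
          have h2 : A / (2 ^ n * R) ^ 2 ≤ θ := by
            rw [hθ]
            gcongr
            exact le_mul_of_one_le_left hRpos.le (one_le_pow₀ one_le_two)
          have h3 : W (2 ^ n * R) ≤ θ * W (2 * (2 ^ n * R)) :=
            h1.trans (mul_le_mul_of_nonneg_right h2 (not_le.mp h0).le)
          calc W R ≤ θ ^ n * (θ * W (2 * (2 ^ n * R))) := ih.trans (by gcongr)
            _ = _ := by ring_nf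
      · exact Or.inr ih
  by_contra hneg
  have bound : ∀ n : ℕ, W R ≤ C * θ ^ n + C * R ^ s * (θ * 2 ^ s) ^ n := by
    intro n
    calc W R ≤ θ ^ n * W (2 ^ n * R) := (iter n).resolve_right hneg
      _ ≤ θ ^ n * (C * (1 + (2 ^ n * R) ^ s)) := by
          gcongr; exact hgrowth _ (by positivity)
      _ = _ := by rw [mul_pow, mul_pow, ← pow_mul, ← pow_mul, mul_comm n s]; ring
  have hl := ((tendsto_pow_atTop_nhds_zero_of_lt_one hθ0 hθ1).const_mul C).add
    ((tendsto_pow_atTop_nhds_zero_of_lt_one (by positivity) hlt).const_mul (C * R ^ s))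
  simp only [mul_zero, add_zero] at hl
  exact hneg (ge_of_tendsto' hl bound)

/-- If a smooth map `u : ℝ^m → ℝ^t` satisfies
`Δ(‖u‖²) ≥ 2‖∇u‖² + 2mε‖u‖²` pointwise for some `ε > 0`, and for some `p ≥ 0`
the function `ρ ↦ ∫_{B_ρ} ‖u‖^{p+2}` is of at most polynomial growth, then `u ≡ 0`. -/
theorem eq_zero_of_strongly_negative_ineq_of_polyGrowth {m t : ℕ} (hm : 1 ≤ m) (ht : 1 ≤ t)
    (ε p : ℝ) (hε : 0 < ε) (hp : 0 ≤ p)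
    (u : EuclideanSpace ℝ (Fin m) → EuclideanSpace ℝ (Fin t)) (hu : ContDiff ℝ (⊤ : ℕ∞) u)
    (hineq : ∀ x, elap (fun y => ‖u y‖ ^ 2) x ≥ 2 * gradSq u x + 2 * m * ε * ‖u x‖ ^ 2)
    (hpoly : ∃ C > (0 : ℝ), ∃ s : ℕ, ∀ ρ > (0 : ℝ),
      (∫ x in Metric.ball (0 : EuclideanSpace ℝ (Fin m)) ρ, ‖u x‖ ^ (p + 2)) ≤ C * (1 + ρ ^ s)) :
    ∀ x, u x = 0 := by
  obtain ⟨C, -, s, hC⟩ := hpoly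
  have hq : 1 ≤ (p + 2) / 2 := by linarith
  have hm0 : (0 : ℝ) < m := by exact_mod_cast hm
  have hf : ContDiff ℝ 2 fun y => ‖u y‖ ^ 2 := (hu.of_le (by norm_cast)).norm_sq ℝ
  have hpow : ∀ x, (‖u x‖ ^ 2) ^ ((p + 2) / 2) = ‖u x‖ ^ (p + 2) := by
    intro x
    rw [← rpow_natCast, ← rpow_mul (norm_nonneg _)]
    congr 1; push_cast; ring
  have hsub : ∀ x, 2 * m * ε * ‖u x‖ ^ 2 ≤ elap (fun y => ‖u y‖ ^ 2) x := by
    intro x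
    have : 0 ≤ gradSq u x := Finset.sum_nonneg fun i _ => sq_nonneg _
    linarith [hineq x]
  obtain ⟨A, hA, hW⟩ := exists_setIntegral_closedBall_le hf (fun x => sq_nonneg _)
    (κ := 2 * m * ε) (by positivity) hq hsub
  simp only [hpow] at hW
  have hcont : Continuous fun x => ‖u x‖ ^ (p + 2) :=
    hu.continuous.norm.rpow_const fun _ => Or.inr (by linarith)
  have hnonneg : ∀ x, 0 ≤ ‖u x‖ ^ (p + 2) := fun x => rpow_nonneg (norm_nonneg _) _
  have hint : ∀ R, IntegrableOn (fun x => ‖u x‖ ^ (p + 2)) (closedBall 0 R) := fun R =>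
    hcont.continuousOn.integrableOn_compact (isCompact_closedBall _ _)
  obtain ⟨R₀, hR₀⟩ := exists_forall_le_nonpos_of_doubling (C := C) (s := s) hA hW (by
    intro R hR
    have : Nontrivial (EuclideanSpace ℝ (Fin m)) := by
      have : Nonempty (Fin m) := ⟨⟨0, hm⟩⟩
      infer_instance
    have hae : ball (0 : EuclideanSpace ℝ (Fin m)) R =ᵐ[volume] closedBall 0 R :=
      ae_eq_of_subset_of_measure_ge ball_subset_closedBall
        (Measure.addHaar_closedBall_eq_addHaar_ball _ _ _).le
        measurableSet_ball.nullMeasurableSet measure_closedBall_lt_top.ne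
    rw [← setIntegral_congr_set hae]
    exact hC R hR)
  intro x
  by_contra hx
  set R := max R₀ (‖x‖ + 1)
  have hpos : 0 < ∫ x in closedBall 0 R, ‖u x‖ ^ (p + 2) := by
    rw [setIntegral_pos_iff_support_of_nonneg_ae
      (Filter.Eventually.of_forall hnonneg) (hint R)]
    refine lt_of_lt_of_le ?_ (measure_mono (Set.inter_subset_inter_right _ ball_subset_closedBall))
    refine (hcont.isOpen_support.inter isOpen_ball).measure_pos _ ⟨x, ?_, ?_⟩
    · exact (rpow_pos_of_pos (norm_pos_iff.mpr hx) _).ne'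
    · rw [mem_ball, dist_zero_right]
      exact (lt_add_one _).trans_le (le_max_right _ _)
  exact (hR₀ R (le_max_left _ _)).not_gt hpos
end
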